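/- Let (X,d) be an (R,D)-thin metric space, let r : [0,∞) → X be a ray, and let y ∈ X with dist(y, r([0,∞))) > D. Let t_j → +∞, and for each j let σ_j : [0, d(y, r(t_j))] → X be a segment with σ_j(0) = y and σ_j(d(y, r(t_j))) = r(t_j) (note d(y, r(t_j)) → ∞). Suppose r_y : [0,∞) → X is a ray such that for every s ≥ 0 one has σ_j(s) → r_y(s) as j → ∞ (σ_j(s) being defined for all large j). Then the ray r is contained in the 2R-neighbourhood of r_y: for every u ≥ 0, dist(r(u), r_y([0,∞))) ≤ 2R. -/

import Mathlib

open Metric Set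

/-- `l` restricted to `[a, b]` is a unit-speed segment (isometric embedding of `[a,b]`). -/
def IsSegmentOn {X : Type*} [PseudoMetricSpace X] (l : ℝ → X) (a b : ℝ) : Prop :=
  ∀ s ∈ Set.Icc a b, ∀ t ∈ Set.Icc a b, dist (l s) (l t) = |s - t|

/-- A ray in `X`: an isometric embedding of `[0, ∞)`. -/
def IsRay {X : Type*} [PseudoMetricSpace X] (r : ℝ → X) : Prop :=
  ∀ s t : ℝ, 0 ≤ s → 0 ≤ t → dist (r s) (r t) = |s - t|

/-- `X` is a geodesic space: any two points are joined by a segment. -/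
def IsGeodesicSpace (X : Type*) [PseudoMetricSpace X] : Prop :=
  ∀ x y : X, ∃ f : ℝ → X, IsSegmentOn f 0 (dist x y) ∧ f 0 = x ∧ f (dist x y) = y

/-- The metric projection of a point `x` to a set `K`:
the set of points of `K` realizing the distance from `x` to `K`. -/
def metricProj {X : Type*} [PseudoMetricSpace X] (K : Set X) (x : X) : Set X :=
  {y ∈ K | dist x y = Metric.infDist x K}

/-- The metric projection of a set `A` to a set `K`. -/
def metricProjSet {X : Type*} [PseudoMetricSpace X] (K A : Set X) : Set X :=
  ⋃ x ∈ A, metricProj K x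

/-- `S` contains a `c`-net of `T`: every point of `T` is within distance `c` of `S`. -/
def ContainsNetOf {X : Type*} [PseudoMetricSpace X] (S T : Set X) (c : ℝ) : Prop :=
  ∀ p ∈ T, ∃ q ∈ S, dist p q ≤ c

/-- An `(R,D)`-thin metric space: a proper, separable, geodesic metric space
(with `R ≥ 20 D > 0`) such that for every segment `l` of length `L > 2R`, every
`t ∈ (R, L - R)` and every `x` whose projection to `l` meets `l(t)`, one has
`dist(x, l) < D`. -/
structure IsThinSpace (X : Type*) [MetricSpace X] (R D : ℝ) : Prop where
  R_pos : 0 < R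
  D_pos : 0 < D
  twentyD_le_R : 20 * D ≤ R
  proper : ProperSpace X
  separable : TopologicalSpace.SeparableSpace X
  geodesic : IsGeodesicSpace X
  thin : ∀ (l : ℝ → X) (L : ℝ), 2 * R < L → IsSegmentOn l 0 L →
    ∀ t ∈ Set.Ioo R (L - R), ∀ x : X,
      dist x (l t) = Metric.infDist x (l '' Set.Icc 0 L) →
      Metric.infDist x (l '' Set.Icc 0 L) < D

/-- A minimizer over a ray of the distance to `x` that lies beyond parameter `R` is within `D`
of `x`. -/
theorem IsThinSpace.dist_lt_of_forall_dist_le {X : Type*} [MetricSpace X] {R D : ℝ}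
    (hX : IsThinSpace X R D) {r : ℝ → X} (hr : IsRay r) {x : X} {c : ℝ} (hc : R < c)
    (hmin : ∀ v, 0 ≤ v → dist x (r c) ≤ dist x (r v)) : dist x (r c) < D := by
  have hR := hX.R_pos
  have hmem : c ∈ Icc 0 (c + R + 1) := ⟨by linarith, by linarith⟩
  have heq : dist x (r c) = infDist x (r '' Icc 0 (c + R + 1)) := by
    apply le_antisymm
    · refine (le_infDist ⟨_, mem_image_of_mem r hmem⟩).2 ?_
      rintro _ ⟨v, hv, rfl⟩
      exact hmin v hv.1
    · exact infDist_le_dist_of_mem (mem_image_of_mem r hmem)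
  rw [heq]
  exact hX.thin r _ (by linarith) (fun s hs t ht => hr s t hs.1 ht.1) c
    ⟨hc, by linarith⟩ x heq

theorem IsRay.continuousOn {X : Type*} [PseudoMetricSpace X] {r : ℝ → X} (hr : IsRay r) :
    ContinuousOn r (Ici 0) :=
  (LipschitzOnWith.of_dist_le_mul (K := 1) fun s hs t ht => by
    simp [hr s t hs ht, Real.dist_eq]).continuousOn

theorem IsSegmentOn.continuousOn {X : Type*} [PseudoMetricSpace X] {l : ℝ → X} {a b : ℝ}
    (hl : IsSegmentOn l a b) : ContinuousOn l (Icc a b) :=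
  (LipschitzOnWith.of_dist_le_mul (K := 1) fun s hs t ht => by
    simp [hl s hs t ht, Real.dist_eq]).continuousOn

theorem IsRay.exists_forall_dist_le {X : Type*} [PseudoMetricSpace X] {r : ℝ → X} (hr : IsRay r)
    (x : X) {w : ℝ} (hw : 0 ≤ w) :
    ∃ c, w ≤ c ∧ ∀ v, w ≤ v → dist x (r c) ≤ dist x (r v) := by
  have hd : 0 ≤ dist x (r w) := dist_nonneg
  have hmem : w ∈ Icc w (w + 2 * dist x (r w)) := ⟨le_rfl, by linarith⟩
  obtain ⟨c, hc, hcmin⟩ := isCompact_Icc.exists_isMinOn ⟨w, hmem⟩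
    ((continuous_const.dist continuous_id).comp_continuousOn
      (hr.continuousOn.mono fun v hv => hw.trans hv.1) : ContinuousOn (fun v => dist x (r v)) _)
  refine ⟨c, hc.1, fun v hv => ?_⟩
  by_cases hv' : v ≤ w + 2 * dist x (r w)
  · exact hcmin ⟨hv, hv'⟩
  · have hcw : dist x (r c) ≤ dist x (r w) := hcmin hmem
    have htri := dist_triangle_left (r v) (r w) x
    rw [hr v w (hw.trans hv) hw, abs_of_nonneg (by linarith)] at htri
    linarith

/-- A segment from a point far from a ray to a point of the ray passes within `2 * D` of every
earlier point of the ray with parameter greater than `R`. -/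
theorem IsThinSpace.exists_dist_segment_le {X : Type*} [MetricSpace X] {R D : ℝ}
    (hX : IsThinSpace X R D) {r : ℝ → X} (hr : IsRay r) {y : X}
    (hy : D < infDist y (r '' Ici 0)) {u t L : ℝ} (hu : R < u) (hut : u ≤ t) (hL : 0 ≤ L)
    {l : ℝ → X} (hl : IsSegmentOn l 0 L) (hl0 : l 0 = y) (hlL : l L = r t) :
    ∃ s ∈ Icc 0 L, dist (r u) (l s) ≤ 2 * D := by
  have hu0 : 0 ≤ u := hX.R_pos.le.trans hu.le
  have hne₁ : (r '' Icc 0 u).Nonempty := (nonempty_Icc.2 hu0).image r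
  have hne₂ : (r '' Ici u).Nonempty := nonempty_Ici.image r
  obtain ⟨s, hs, hseq⟩ : ∃ s ∈ Icc 0 L,
      infDist (l s) (r '' Icc 0 u) - infDist (l s) (r '' Ici u) = 0 := by
    have hcont : ContinuousOn
        (fun s => infDist (l s) (r '' Icc 0 u) - infDist (l s) (r '' Ici u)) (Icc 0 L) :=
      ((continuous_infDist_pt _).comp_continuousOn hl.continuousOn).sub
        ((continuous_infDist_pt _).comp_continuousOn hl.continuousOn)
    refine intermediate_value_Icc hL hcont ⟨?_, ?_⟩
    · obtain ⟨c, hc0, hc⟩ := hr.exists_forall_dist_le y le_rfl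
      have hcR : c ≤ R := by
        by_contra! hRc
        have hlt := hX.dist_lt_of_forall_dist_le hr hRc hc
        have hle : infDist y (r '' Ici 0) ≤ dist y (r c) :=
          infDist_le_dist_of_mem (mem_image_of_mem r hc0)
        linarith
      have h₁ : infDist y (r '' Icc 0 u) ≤ dist y (r c) :=
        infDist_le_dist_of_mem (mem_image_of_mem r ⟨hc0, hcR.trans hu.le⟩)
      have h₂ : dist y (r c) ≤ infDist y (r '' Ici u) := by
        refine (le_infDist hne₂).2 ?_
        rintro _ ⟨v, hv, rfl⟩
        exact hc v (hu0.trans hv)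
      simp only [hl0]
      linarith
    · have h₁ : infDist (r t) (r '' Ici u) = 0 := infDist_zero_of_mem (mem_image_of_mem r hut)
      simp only [hlL, h₁, sub_zero]
      exact infDist_nonneg
  obtain ⟨b, hb, hbmin⟩ := hr.exists_forall_dist_le (l s) hu0
  obtain ⟨_, ⟨a, ha, rfl⟩, hamin⟩ := (isCompact_Icc.image_of_continuousOn
    (hr.continuousOn.mono fun v hv => hv.1)).exists_infDist_eq_dist hne₁ (l s)
  have hbeq : infDist (l s) (r '' Ici u) = dist (l s) (r b) := by
    refine le_antisymm (infDist_le_dist_of_mem (mem_image_of_mem r hb)) ((le_infDist hne₂).2 ?_)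
    rintro _ ⟨v, hv, rfl⟩
    exact hbmin v hv
  have hbD : dist (l s) (r b) < D := by
    refine hX.dist_lt_of_forall_dist_le hr (hu.trans_le hb) fun v hv => ?_
    rcases le_total u v with huv | hvu
    · exact hbmin v huv
    · have hle : infDist (l s) (r '' Icc 0 u) ≤ dist (l s) (r v) :=
        infDist_le_dist_of_mem (mem_image_of_mem r ⟨hv, hvu⟩)
      linarith
  have haD : dist (l s) (r a) < D := by linarith
  refine ⟨s, hs, ?_⟩
  have hab := dist_triangle_left (r b) (r a) (l s)
  have hua := dist_triangle_right (r u) (l s) (r a)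
  have hub := dist_triangle_right (r u) (l s) (r b)
  rw [hr b a (hu0.trans hb) ha.1, abs_of_nonneg (by linarith [ha.2])] at hab
  rw [hr u a hu0 ha.1, abs_of_nonneg (by linarith [ha.2])] at hua
  rw [hr u b hu0 (hu0.trans hb), abs_of_nonpos (by linarith)] at hub
  rcases le_total (u - a) D with h | h <;> linarith

/-- A uniform bound on the distance from `p` to the segments `σ j` from `y` passes to a
pointwise limit ray. -/
theorem infDist_limit_ray_le {X : Type*} [PseudoMetricSpace X] {p y : X} {C : ℝ}
    {L : ℕ → ℝ} (hL : Filter.Tendsto L Filter.atTop Filter.atTop) {σ : ℕ → ℝ → X}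
    (hσ : ∀ j, IsSegmentOn (σ j) 0 (L j)) (hσ0 : ∀ j, σ j 0 = y) {ry : ℝ → X}
    (hconv : ∀ s : ℝ, 0 ≤ s →
      Filter.Tendsto (fun j => σ j s) Filter.atTop (nhds (ry s)))
    (hnear : ∀ᶠ j in Filter.atTop, ∃ s ∈ Icc 0 (L j), dist p (σ j s) ≤ C) :
    infDist p (ry '' Ici 0) ≤ C := by
  have hbdd : ∀ᶠ j in Filter.atTop,
      ∃ s ∈ Icc 0 (dist y p + C), s ≤ L j ∧ dist p (σ j s) ≤ C := by
    filter_upwards [hnear] with j ⟨s, hs, hps⟩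
    refine ⟨s, ⟨hs.1, ?_⟩, hs.2, hps⟩
    have h := hσ j 0 ⟨le_rfl, hs.1.trans hs.2⟩ s hs
    rw [hσ0, zero_sub, abs_neg, abs_of_nonneg hs.1] at h
    linarith [dist_triangle y p (σ j s)]
  obtain ⟨N, hN⟩ := Filter.eventually_atTop.1 hbdd
  choose! τ hτ using hN
  obtain ⟨s, hs, φ, hφ, hlim⟩ := isCompact_Icc.tendsto_subseq
    (x := fun k => τ (k + N)) fun k => (hτ (k + N) (Nat.le_add_left N k)).1
  have hφN : Filter.Tendsto (fun k => φ k + N) Filter.atTop Filter.atTop :=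
    (Filter.tendsto_add_atTop_nat N).comp hφ.tendsto_atTop
  have hle : dist p (ry s) ≤ C := by
    have hbound : Filter.Tendsto
        (fun k => C + dist (τ (φ k + N)) s + dist (σ (φ k + N) s) (ry s))
        Filter.atTop (nhds (C + 0 + 0)) :=
      (tendsto_const_nhds.add (tendsto_iff_dist_tendsto_zero.1 hlim)).add
        (tendsto_iff_dist_tendsto_zero.1 ((hconv s hs.1).comp hφN))
    rw [add_zero, add_zero] at hbound
    refine ge_of_tendsto hbound ?_
    filter_upwards [(hL.comp hφN).eventually_ge_atTop s] with k hk
    obtain ⟨hτmem, hτL, hτC⟩ := hτ (φ k + N) (Nat.le_add_left N _)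
    have hseg := hσ (φ k + N) _ ⟨hτmem.1, hτL⟩ s ⟨hs.1, hk⟩
    rw [← Real.dist_eq] at hseg
    have htri := dist_triangle4 p (σ (φ k + N) (τ (φ k + N))) (σ (φ k + N) s) (ry s)
    linarith
  exact (infDist_le_dist_of_mem (mem_image_of_mem ry hs.1)).trans hle

/-- Lemma 4.10: in an `(R,D)`-thin space, if `y` is at distance `> D`
from a ray `r`, and `r_y` is a ray obtained as a limit of segments from `y` to `r(t_j)`
with `t_j → ∞`, then `r` is contained in the `2R`-neighbourhood of `r_y`. -/
theorem thin_ray_in_nbhd_of_limit_ray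
    {X : Type*} [MetricSpace X] {R D : ℝ} (hX : IsThinSpace X R D)
    {r : ℝ → X} (hr : IsRay r) {y : X} (hy : D < Metric.infDist y (r '' Set.Ici 0))
    {t : ℕ → ℝ} (ht : Filter.Tendsto t Filter.atTop Filter.atTop)
    {σ : ℕ → ℝ → X}
    (hσ : ∀ j, IsSegmentOn (σ j) 0 (dist y (r (t j))) ∧ σ j 0 = y ∧
      σ j (dist y (r (t j))) = r (t j))
    {ry : ℝ → X} (hry : IsRay ry)
    (hconv : ∀ s : ℝ, 0 ≤ s →
      Filter.Tendsto (fun j => σ j s) Filter.atTop (nhds (ry s))) :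
    ∀ u : ℝ, 0 ≤ u → Metric.infDist (r u) (ry '' Set.Ici 0) ≤ 2 * R := by
  have hD := hX.D_pos
  have hDR := hX.twentyD_le_R
  have hL : Filter.Tendsto (fun j => dist y (r (t j))) Filter.atTop Filter.atTop := by
    refine Filter.tendsto_atTop_mono' _ ?_
      (Filter.tendsto_atTop_add_const_right _ (-dist y (r 0)) ht)
    filter_upwards [ht.eventually_ge_atTop 0] with j hj
    have h := dist_triangle_left (r (t j)) (r 0) y
    rw [hr _ _ hj le_rfl, sub_zero, abs_of_nonneg hj] at h
    linarith
  have hfar : ∀ u, R < u → infDist (r u) (ry '' Ici 0) ≤ 2 * D := fun u hu => by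
    refine infDist_limit_ray_le hL (fun j => (hσ j).1) (fun j => (hσ j).2.1) hconv ?_
    filter_upwards [ht.eventually_ge_atTop u] with j hj
    exact hX.exists_dist_segment_le hr hy hu hj dist_nonneg (hσ j).1 (hσ j).2.1 (hσ j).2.2
  intro u hu
  rcases lt_or_ge R u with hRu | huR
  · linarith [hfar u hRu]
  · have h := hfar (R + D) (by linarith)
    have htri : infDist (r u) (ry '' Ici 0) ≤
        infDist (r (R + D)) (ry '' Ici 0) + dist (r u) (r (R + D)) :=
      infDist_le_infDist_add_dist
    rw [hr u (R + D) hu (by linarith), abs_of_nonpos (by linarith)] at htri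
    linarith
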